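/- For integers r ≥ 1 and 0 ≤ m ≤ r−1, in ℚ[[q]]: Σ_{(λ^{(1)},…,λ^{(r)}) ∈ S(r,m)} q^{Σ_{i=1}^r |λ^{(i)}|} = Σ_{ρ_1 ≥ ρ_2 ≥ … ≥ ρ_r ≥ 0} (q^{Σ_{i=1}^r ρ_i(ρ_i+1)/2} / (q)_ρ) · (1 + Σ_{i=0}^{m−1} q^{Σ_{j=0}^{i} (ρ_{r−m+j} + 1)}), where the sum on the right is over weakly decreasing r-tuples of nonnegative integers. -/

import Mathlib

open PowerSeries

noncomputable section

/-- The product (coefficientwise) topology on `ℚ⟦X⟧`. -/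
instance : TopologicalSpace ℚ⟦X⟧ :=
  inferInstanceAs (TopologicalSpace ((Unit →₀ ℕ) → ℚ))

/-- `(q)_n = ∏_{i=1}^n (1 - q^i)` in `ℚ⟦X⟧`. -/
def qp (n : ℕ) : ℚ⟦X⟧ := ∏ i ∈ Finset.range n, (1 - X ^ (i + 1))

/-- `(-q)_n = ∏_{i=1}^n (1 + q^i)` in `ℚ⟦X⟧`. -/
def nqp (n : ℕ) : ℚ⟦X⟧ := ∏ i ∈ Finset.range n, (1 + X ^ (i + 1))

/-- The Gaussian binomial `[M, N]_q`, zero unless `M ≥ N`. -/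
def qbinom (M N : ℕ) : ℚ⟦X⟧ :=
  if N ≤ M then qp M * ((qp N)⁻¹ * (qp (M - N))⁻¹) else 0

/-- Weakly decreasing tuples `f 0 ≥ f 1 ≥ … ≥ f (r-1) ≥ 0`, encoded as
antitone functions `ℕ → ℕ` vanishing from index `r` on. -/
def DecTuple (r : ℕ) : Type :=
  {f : ℕ → ℕ // (∀ ⦃i j : ℕ⦄, i ≤ j → f j ≤ f i) ∧ ∀ i, r ≤ i → f i = 0}

/-- `(q)_λ = (q)_{λ_1-λ_2} ⋯ (q)_{λ_{r-1}-λ_r} (q)_{λ_r}` for a weakly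
decreasing tuple `λ` (0-indexed). -/
def qpT (r : ℕ) (f : ℕ → ℕ) : ℚ⟦X⟧ := ∏ i ∈ Finset.range r, qp (f i - f (i + 1))


/-- Tuples `(λ^(1), …, λ^(r))` of distinct-part partitions (a distinct-part
partition being encoded as its finite set of (positive) parts, `L i` encoding
`λ^(i+1)`) satisfying `λ^(i)_1 ≤ l(λ^(i+1)) + δ_{i,m}` for `1 ≤ i ≤ r-1`;
here `(L i).sup id` is the largest part and `(L i).card` the number of parts. -/
def Srm (r m : ℕ) : Set (ℕ → Finset ℕ) :=
  {L | (∀ i, r ≤ i → L i = ∅) ∧ (∀ i, 0 ∉ L i) ∧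
    ∀ i, i + 2 ≤ r → (L i).sup id ≤ (L (i + 1)).card + if i + 1 = m then 1 else 0}

/-- The subset `S(r,m)_n` of `S(r,m)` where the total size is `n`. -/
def Srmn (r m n : ℕ) : Set (ℕ → Finset ℕ) :=
  {L ∈ Srm r m | ∑ i ∈ Finset.range r, (L i).sum id = n}

theorem hasSum_powerSeries_iff {ι : Type*} (F : ι → ℚ⟦X⟧) (a : ℚ⟦X⟧) :
    HasSum F a ↔ ∀ d, HasSum (fun i => coeff d (F i)) (coeff d a) := by
  have h : HasSum F a ↔ ∀ x : Unit →₀ ℕ, HasSum (fun i => F i x) (a x) :=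
    Pi.hasSum (X := fun _ : Unit →₀ ℕ => ℚ)
  rw [h]
  constructor
  · intro h d
    exact h (Finsupp.single () d)
  · intro h x
    have hx : x = Finsupp.single () (x ()) := by
      ext
      simp
    rw [hx]
    exact h (x ())

/-- The generating function of the sets of `b` distinct parts, all at most `a`. -/
def distinctGF (a b : ℕ) : ℚ⟦X⟧ := ∑ S ∈ (Finset.Icc 1 a).powersetCard b, X ^ S.sum id

theorem distinctGF_zero_right (a : ℕ) : distinctGF a 0 = 1 := by
  simp [distinctGF]

theorem distinctGF_eq_zero {a b : ℕ} (h : a < b) : distinctGF a b = 0 := by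
  rw [distinctGF, Finset.powersetCard_eq_empty.2 (by simpa using h), Finset.sum_empty]

theorem distinctGF_succ_succ (a b : ℕ) :
    distinctGF (a + 1) (b + 1) = distinctGF a (b + 1) + X ^ (a + 1) * distinctGF a b := by
  have hI : Finset.Icc 1 (a + 1) = insert (a + 1) (Finset.Icc 1 a) := by
    ext x
    simp only [Finset.mem_Icc, Finset.mem_insert]
    omega
  have hn : a + 1 ∉ Finset.Icc 1 a := by simp
  have hnS : ∀ (c : ℕ), ∀ S ∈ (Finset.Icc 1 a).powersetCard c, a + 1 ∉ S := fun c S hS h =>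
    hn ((Finset.mem_powersetCard.1 hS).1 h)
  rw [distinctGF, hI, Finset.powersetCard_succ_insert hn, Finset.sum_union, Finset.sum_image]
  · rw [distinctGF, distinctGF, Finset.mul_sum]
    congr 1
    refine Finset.sum_congr rfl fun S hS => ?_
    rw [Finset.sum_insert (hnS b S hS), id, pow_add]
  · intro S hS T hT hST
    rw [← Finset.erase_insert (hnS b S hS), ← Finset.erase_insert (hnS b T hT)]
    exact congrArg (fun U => Finset.erase U (a + 1)) hST
  · rw [Finset.disjoint_left]
    intro S hS hS'
    obtain ⟨T, -, rfl⟩ := Finset.mem_image.1 hS'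
    exact hnS _ _ hS (Finset.mem_insert_self _ _)

theorem triangle_succ (b : ℕ) : (b + 1) * (b + 1 + 1) / 2 = b * (b + 1) / 2 + (b + 1) := by
  rw [show (b + 1) * (b + 1 + 1) = b * (b + 1) + (b + 1) * 2 by ring,
    Nat.add_mul_div_right _ _ (by norm_num)]

theorem le_triangle (b : ℕ) : b ≤ b * (b + 1) / 2 := by
  cases b with
  | zero => simp
  | succ b => rw [triangle_succ]; omega

theorem qp_succ (n : ℕ) : qp (n + 1) = qp n * (1 - X ^ (n + 1)) := by
  rw [qp, Finset.prod_range_succ, ← qp]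

theorem constantCoeff_qp (n : ℕ) : constantCoeff (qp n) = 1 := by
  rw [qp, map_prod]
  exact Finset.prod_eq_one fun i _ => by simp

theorem distinctGF_mul_qp_mul_qp (n b : ℕ) :
    distinctGF (n + b) b * qp b * qp n = X ^ (b * (b + 1) / 2) * qp (n + b) := by
  induction b generalizing n with
  | zero => simp [distinctGF_zero_right, qp]
  | succ b ihb =>
    induction n with
    | zero =>
      have h0 := ihb 0
      rw [zero_add] at h0 ⊢
      rw [distinctGF_succ_succ, distinctGF_eq_zero (Nat.lt_succ_self b), triangle_succ, qp_succ,
        pow_add]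
      linear_combination (X ^ (b + 1) * (1 - X ^ (b + 1))) * h0
    | succ n ihn =>
      have h1 := ihb (n + 1)
      rw [show n + 1 + b = n + (b + 1) by ring] at h1
      rw [show n + 1 + (b + 1) = n + (b + 1) + 1 by ring, distinctGF_succ_succ]
      rw [triangle_succ, pow_add, qp_succ b] at ihn ⊢
      rw [qp_succ n] at h1 ⊢
      rw [qp_succ (n + (b + 1))]
      linear_combination (1 - X ^ (n + 1)) * ihn +
        (X ^ (n + (b + 1) + 1) * (1 - X ^ (b + 1))) * h1

theorem X_pow_dvd_qp_sub_qp (n b : ℕ) : (X : ℚ⟦X⟧) ^ (n + 1) ∣ qp (n + b) - qp n := by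
  induction b with
  | zero => simp
  | succ b ih =>
    have h : qp (n + (b + 1)) - qp n
        = (qp (n + b) - qp n) - X ^ (n + 1) * (X ^ b * qp (n + b)) := by
      rw [← add_assoc, qp_succ]
      ring
    rw [h]
    exact dvd_sub ih (Dvd.intro _ rfl)

theorem X_pow_dvd_distinctGF_mul_qp_sub (D b : ℕ) :
    (X : ℚ⟦X⟧) ^ (D + 1) ∣ distinctGF D b * qp b - X ^ (b * (b + 1) / 2) := by
  have hb := le_triangle b
  by_cases h : b ≤ D
  · obtain ⟨n, rfl⟩ := Nat.exists_eq_add_of_le' h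
    have hu : IsUnit (qp n) := by
      rw [PowerSeries.isUnit_iff_constantCoeff, constantCoeff_qp]
      exact isUnit_one
    rw [← hu.dvd_mul_right, sub_mul, distinctGF_mul_qp_mul_qp, ← mul_sub]
    calc (X : ℚ⟦X⟧) ^ (n + b + 1) ∣ X ^ (b * (b + 1) / 2) * X ^ (n + 1) := by
          rw [← pow_add]
          exact pow_dvd_pow _ (by omega)
      _ ∣ _ := mul_dvd_mul_left _ (X_pow_dvd_qp_sub_qp n b)
  · rw [distinctGF_eq_zero (by omega), zero_mul, zero_sub, dvd_neg]
    exact pow_dvd_pow _ (by omega)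

/-- The sequence `N, f 0, f 1, …`. -/
def consSeq (N : ℕ) (f : ℕ → ℕ) : ℕ → ℕ
  | 0 => N
  | t + 1 => f t

/-- Extension of a finite tuple of bounded numbers by zero. -/
def extendZero {r M : ℕ} (ρ : Fin r → Fin M) (t : ℕ) : ℕ := if h : t < r then ρ ⟨t, h⟩ else 0

/-- The sum over all paths `N, b₀, …, b_{r-1}` with `b_t < M` of the product of the weights
`K t b_{t-1} b_t` of their steps. -/
def pathSum (M : ℕ) : ℕ → (ℕ → ℕ → ℕ → ℚ⟦X⟧) → ℕ → ℚ⟦X⟧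
  | 0, _, _ => 1
  | r + 1, K, N => ∑ b ∈ Finset.range M, K 0 N b * pathSum M r (fun t => K (t + 1)) b

theorem pathSum_eq_sum (M r : ℕ) (K : ℕ → ℕ → ℕ → ℚ⟦X⟧) (N : ℕ) :
    pathSum M r K N = ∑ ρ : Fin r → Fin M,
      ∏ t ∈ Finset.range r, K t (consSeq N (extendZero ρ) t) (extendZero ρ t) := by
  induction r generalizing K N with
  | zero => simp [pathSum]
  | succ r ih =>
    rw [pathSum, ← (Fin.consEquiv fun _ : Fin (r + 1) => Fin M).sum_comp, Fintype.sum_prod_type,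
      Finset.sum_range]
    refine Finset.sum_congr rfl fun b _ => ?_
    rw [ih, Finset.mul_sum]
    refine Finset.sum_congr rfl fun ρ _ => ?_
    have h0 : extendZero (Fin.cons b ρ : Fin (r + 1) → Fin M) 0 = b := by
      simp [extendZero]
    have h1 : ∀ t, extendZero (Fin.cons b ρ : Fin (r + 1) → Fin M) (t + 1) = extendZero ρ t := by
      intro t
      by_cases ht : t < r
      · rw [extendZero, extendZero, dif_pos ht, dif_pos (by omega)]
        rfl
      · rw [extendZero, extendZero, dif_neg ht, dif_neg (by omega)]
    have h2 : ∀ t, consSeq N (extendZero (Fin.cons b ρ : Fin (r + 1) → Fin M)) (t + 1)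
        = consSeq b (extendZero ρ) t := by
      intro t
      cases t with
      | zero => exact h0
      | succ t => exact h1 t
    rw [Finset.prod_range_succ']
    rw [mul_comm]
    change _ = (∏ t ∈ Finset.range r,
        K (t + 1) (consSeq N (extendZero (Fin.cons b ρ : Fin (r + 1) → Fin M)) (t + 1))
          (extendZero (Fin.cons b ρ : Fin (r + 1) → Fin M) (t + 1))) *
      K 0 N (extendZero (Fin.cons b ρ : Fin (r + 1) → Fin M) 0)
    simp only [h0, h1, h2]

/-- The weights counting sets of distinct parts by size, the bound being relaxed by one at
step `p`. -/
def relaxedWeight (p t a b : ℕ) : ℚ⟦X⟧ := distinctGF (a + if t = p then 1 else 0) b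

/-- The weights counting sets of distinct parts by size, with an additional factor in the
steps `p, …, p + i - 1`. -/
def markedWeight (p i t a b : ℕ) : ℚ⟦X⟧ :=
  (if p ≤ t ∧ t < p + i then X ^ (a + 1) else 1) * distinctGF a b

theorem markedWeight_zero (p : ℕ) : markedWeight p 0 = fun _ => distinctGF := by
  funext t a b
  rw [markedWeight, if_neg (by omega), one_mul]

theorem markedWeight_succ_shift (p i : ℕ) :
    (fun t => markedWeight (p + 1) i (t + 1)) = markedWeight p i := by
  funext t a b
  simp only [markedWeight]
  congr 1
  exact if_congr (by omega) rfl rfl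

theorem markedWeight_zero_shift (i : ℕ) :
    (fun t => markedWeight 0 (i + 1) (t + 1)) = markedWeight 0 i := by
  funext t a b
  simp only [markedWeight]
  congr 1
  exact if_congr (by omega) rfl rfl

theorem pathSum_distinctGF_succ (M m N : ℕ) (hN : N + 1 < M) :
    pathSum M m (fun _ => distinctGF) (N + 1) =
      ∑ i ∈ Finset.range (m + 1), pathSum M m (markedWeight 0 i) N := by
  induction m generalizing N with
  | zero => simp [pathSum]
  | succ m ih =>
    obtain ⟨M, rfl⟩ : ∃ M', M = M' + 1 := ⟨M - 1, by omega⟩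
    rw [Finset.sum_range_succ', markedWeight_zero]
    have hstep : ∀ i, pathSum (M + 1) (m + 1) (markedWeight 0 (i + 1)) N =
        X ^ (N + 1) * ∑ b ∈ Finset.range M,
          distinctGF N b * pathSum (M + 1) m (markedWeight 0 i) b := by
      intro i
      rw [pathSum, Finset.sum_range_succ, markedWeight_zero_shift, Finset.mul_sum]
      simp [markedWeight, distinctGF_eq_zero (show N < M by omega), mul_assoc]
    simp only [hstep]
    rw [← Finset.mul_sum, Finset.sum_comm, pathSum, pathSum, Finset.sum_range_succ',
      Finset.sum_range_succ' _ M]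
    simp only [distinctGF_succ_succ, distinctGF_zero_right, add_mul, Finset.sum_add_distrib]
    have hsum : ∑ b ∈ Finset.range M, X ^ (N + 1) * distinctGF N b *
          pathSum (M + 1) m (fun _ => distinctGF) (b + 1) =
        X ^ (N + 1) * ∑ b ∈ Finset.range M, ∑ i ∈ Finset.range (m + 1),
          distinctGF N b * pathSum (M + 1) m (markedWeight 0 i) b := by
      rw [Finset.mul_sum]
      refine Finset.sum_congr rfl fun b _ => ?_
      rw [mul_assoc, ← Finset.mul_sum]
      by_cases h : b ≤ N
      · rw [ih b (by omega)]
      · simp [distinctGF_eq_zero (show N < b by omega)]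
    linear_combination hsum

theorem pathSum_relaxedWeight (M m p N : ℕ) (hN : N + 1 < M) :
    pathSum M (p + m) (relaxedWeight p) N =
      ∑ i ∈ Finset.range (m + 1), pathSum M (p + m) (markedWeight p i) N := by
  induction p generalizing N with
  | zero =>
    rw [zero_add, ← pathSum_distinctGF_succ M m N hN]
    cases m with
    | zero => rfl
    | succ m =>
      have h : (fun t => relaxedWeight 0 (t + 1)) = fun _ => distinctGF := by
        funext t a b
        simp [relaxedWeight]
      simp [pathSum, h, relaxedWeight]
  | succ p ih =>
    rw [show p + 1 + m = p + m + 1 by ring]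
    simp only [pathSum, markedWeight_succ_shift]
    rw [Finset.sum_comm]
    refine Finset.sum_congr rfl fun b _ => ?_
    have h1 : (fun t => relaxedWeight (p + 1) (t + 1)) = relaxedWeight p := by
      funext t a b
      simp [relaxedWeight]
    have h2 : ∀ i, markedWeight (p + 1) i 0 N b = distinctGF N b := by
      intro i
      simp [markedWeight]
    simp only [h1, h2]
    rw [← Finset.mul_sum]
    by_cases hb : b ≤ N
    · rw [ih b (by omega)]
      simp [relaxedWeight]
    · simp [relaxedWeight, distinctGF_eq_zero (show N < b by omega)]

theorem extendZero_coe {r M : ℕ} (ρ : Fin r → Fin M) (i : Fin r) : extendZero ρ i = ρ i := by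
  simp [extendZero]

/-- The tuples of sets of distinct parts, in reversed order and together with the tuple of their
sizes, that satisfy the conditions in `Srm r m` and have all parts of the first set at most `d`. -/
def boundedTuples (r m d : ℕ) : Finset (Σ _ : Fin r → Fin (d + 2), Fin r → Finset ℕ) :=
  Finset.univ.sigma fun ρ => Fintype.piFinset fun i : Fin r =>
    (Finset.Icc 1 (consSeq d (extendZero ρ) i + if (i : ℕ) = r - m then 1 else 0)).powersetCard
      (ρ i)

theorem mem_boundedTuples {r m d : ℕ} {x : Σ _ : Fin r → Fin (d + 2), Fin r → Finset ℕ} :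
    x ∈ boundedTuples r m d ↔ ∀ i : Fin r,
      x.2 i ⊆ Finset.Icc 1 (consSeq d (extendZero x.1) i + if (i : ℕ) = r - m then 1 else 0) ∧
        (x.2 i).card = x.1 i := by
  simp [boundedTuples]

theorem pathSum_relaxedWeight_eq_sum (r m d : ℕ) :
    pathSum (d + 2) r (relaxedWeight (r - m)) d =
      ∑ x ∈ boundedTuples r m d, X ^ ∑ i, (x.2 i).sum id := by
  rw [pathSum_eq_sum, boundedTuples, Finset.sum_sigma]
  refine Finset.sum_congr rfl fun ρ _ => ?_
  have hX : ∀ S : Fin r → Finset ℕ, (X : ℚ⟦X⟧) ^ ∑ i, (S i).sum id = ∏ i, X ^ (S i).sum id :=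
    fun S => (Finset.prod_pow_eq_pow_sum _ _ _).symm
  simp only [hX]
  rw [Finset.prod_range, ← Finset.prod_univ_sum
    (fun i : Fin r => (Finset.Icc 1 (consSeq d (extendZero ρ) i +
      if (i : ℕ) = r - m then 1 else 0)).powersetCard (ρ i)) (fun _ S => (X : ℚ⟦X⟧) ^ S.sum id)]
  refine Finset.prod_congr rfl fun i _ => ?_
  rw [relaxedWeight, distinctGF, extendZero_coe]

/-- Reversal of a finite tuple, extended by the empty set. -/
def reverseTuple {r : ℕ} (S : Fin r → Finset ℕ) (j : ℕ) : Finset ℕ :=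
  if h : j < r then S ⟨r - 1 - j, by omega⟩ else ∅

theorem reverseTuple_reverse {r : ℕ} (S : Fin r → Finset ℕ) (i : Fin r) :
    reverseTuple S (r - 1 - i) = S i := by
  have hi := i.2
  rw [reverseTuple, dif_pos (by omega)]
  congr 1
  ext
  simp only
  omega

theorem sum_reverseTuple {r : ℕ} (S : Fin r → Finset ℕ) :
    ∑ j ∈ Finset.range r, (reverseTuple S j).sum id = ∑ i, (S i).sum id := by
  rw [← Finset.sum_range_reflect, Finset.sum_range]
  simp only [reverseTuple_reverse]

theorem reverseTuple_mem_Srm {r m d : ℕ} (hm : m < r)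
    {x : Σ _ : Fin r → Fin (d + 2), Fin r → Finset ℕ} (hx : x ∈ boundedTuples r m d) :
    reverseTuple x.2 ∈ Srm r m := by
  rw [mem_boundedTuples] at hx
  refine ⟨fun i hi => dif_neg (by omega), fun i h => ?_, fun i hi => ?_⟩
  · rw [reverseTuple] at h
    split_ifs at h with hi
    · simpa using (hx _).1 h
    · simp at h
  · obtain ⟨t, rfl⟩ : ∃ t, r = t + 1 + i + 1 := ⟨r - i - 2, by omega⟩
    have h0 := (hx ⟨t, by omega⟩).2
    have h1 := (hx ⟨t + 1, by omega⟩).1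
    have e0 := reverseTuple_reverse x.2 ⟨t, by omega⟩
    have e1 := reverseTuple_reverse x.2 ⟨t + 1, by omega⟩
    simp only at e0 e1
    rw [show t + 1 + i + 1 - 1 - t = i + 1 by omega] at e0
    rw [show t + 1 + i + 1 - 1 - (t + 1) = i by omega] at e1
    rw [e0, e1, h0]
    refine Finset.sup_le fun a ha => ?_
    have ha := (Finset.mem_Icc.1 (h1 ha)).2
    have e2 := extendZero_coe x.1 ⟨t, by omega⟩
    simp only [consSeq] at ha e2
    rw [e2] at ha
    have hiff : (i + 1 = m) = (t + 1 = t + 1 + i + 1 - m) := propext (by omega)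
    simp only [hiff]
    exact ha

theorem card_le_sum {S : Finset ℕ} (h : 0 ∉ S) : S.card ≤ S.sum id := by
  rw [Finset.card_eq_sum_ones]
  exact Finset.sum_le_sum fun a ha => Nat.pos_of_ne_zero fun h0 => h (h0 ▸ ha)

theorem exists_reverseTuple_eq {r m : ℕ} (hm : m < r) {L : ℕ → Finset ℕ} (hL : L ∈ Srm r m) :
    ∃ x ∈ boundedTuples r m (∑ i ∈ Finset.range r, (L i).sum id), reverseTuple x.2 = L := by
  obtain ⟨hL0, hLpos, hLsup⟩ := hL
  set d := ∑ i ∈ Finset.range r, (L i).sum id with hd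
  have hsum : ∀ j, (L j).sum id ≤ d := by
    intro j
    by_cases hj : j < r
    · exact Finset.single_le_sum (f := fun i => (L i).sum id) (fun _ _ => Nat.zero_le _)
        (Finset.mem_range.2 hj)
    · simp [hL0 j (by omega)]
  have hcard : ∀ j, (L j).card < d + 2 := fun j => by
    have := card_le_sum (hLpos j)
    have := hsum j
    omega
  refine ⟨⟨fun i => ⟨(L (r - 1 - i)).card, hcard _⟩, fun i => L (r - 1 - i)⟩, ?_, ?_⟩
  · rw [mem_boundedTuples]
    refine fun i => ⟨fun a ha => ?_, rfl⟩
    simp only at ha ⊢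
    rw [Finset.mem_Icc]
    refine ⟨Nat.pos_of_ne_zero fun h0 => hLpos _ (h0 ▸ ha), ?_⟩
    obtain ⟨t, ht⟩ := i
    cases t with
    | zero =>
      have h1 : a ≤ (L (r - 1 - 0)).sum id :=
        Finset.single_le_sum (f := id) (fun _ _ => Nat.zero_le _) ha
      exact (h1.trans (hsum _)).trans (Nat.le_add_right _ _)
    | succ t =>
      have h1 : a ≤ (L (r - 1 - (t + 1))).sup id := Finset.le_sup (f := id) ha
      have h2 := h1.trans (hLsup (r - 1 - (t + 1)) (by omega))
      rw [show r - 1 - (t + 1) + 1 = r - 1 - t by omega] at h2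
      simp only [consSeq, extendZero, dif_pos (show t < r by omega)]
      convert h2 using 2
      exact if_congr (by omega) rfl rfl
  · funext j
    by_cases hj : j < r
    · simp only [reverseTuple, dif_pos hj]
      congr 1
      omega
    · rw [reverseTuple, dif_neg hj, hL0 j (by omega)]

theorem hasSum_coeff_Srm {r m : ℕ} (hm : m < r) (d : ℕ) :
    HasSum (fun L : Srm r m =>
        coeff d ((X : ℚ⟦X⟧) ^ ∑ i ∈ Finset.range r, (L.1 i).sum id))
      (coeff d (pathSum (d + 2) r (relaxedWeight (r - m)) d)) := by
  let g : {x // x ∈ boundedTuples r m d} → Srm r m :=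
    fun x => ⟨reverseTuple x.1.2, reverseTuple_mem_Srm hm x.2⟩
  have hg : Function.Injective g := by
    rintro ⟨⟨ρ, S⟩, hx⟩ ⟨⟨σ, T⟩, hy⟩ h
    have h' : reverseTuple S = reverseTuple T := congrArg Subtype.val h
    have hST : S = T := by
      funext i
      rw [← reverseTuple_reverse S, h', reverseTuple_reverse]
    subst hST
    have : ρ = σ := by
      funext i
      rw [mem_boundedTuples] at hx hy
      exact Fin.ext ((hx i).2.symm.trans (hy i).2)
    rw [Subtype.mk.injEq, this]
  rw [← hg.hasSum_iff]
  · rw [pathSum_relaxedWeight_eq_sum, map_sum, ← Finset.sum_coe_sort]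
    convert hasSum_fintype _ using 3 with x
    simp only [Function.comp, g, sum_reverseTuple]
  · intro L hL
    rw [coeff_X_pow, if_neg]
    rintro rfl
    obtain ⟨x, hx, h⟩ := exists_reverseTuple_eq hm L.2
    exact hL ⟨⟨x, hx⟩, Subtype.ext h⟩

theorem qpT_succ (n : ℕ) (f : ℕ → ℕ) : qpT (n + 1) f = qpT n f * qp (f n - f (n + 1)) := by
  rw [qpT, Finset.prod_range_succ, ← qpT]

theorem prod_distinctGF_mul_qpT (n N : ℕ) (f : ℕ → ℕ) (hf : Antitone f) :
    (∏ t ∈ Finset.range (n + 1), distinctGF (consSeq N f t) (f t)) * qpT n f * qp (f n) =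
      distinctGF N (f 0) * qp (f 0) *
        X ^ ∑ t ∈ Finset.range n, f (t + 1) * (f (t + 1) + 1) / 2 := by
  induction n with
  | zero => simp [qpT, consSeq]
  | succ n ih =>
    have h := distinctGF_mul_qp_mul_qp (f n - f (n + 1)) (f (n + 1))
    rw [Nat.sub_add_cancel (hf n.le_succ)] at h
    rw [Finset.prod_range_succ, Finset.sum_range_succ, qpT_succ, pow_add]
    change (_ * distinctGF (f n) (f (n + 1))) * _ * _ = _
    linear_combination (∏ t ∈ Finset.range (n + 1), distinctGF (consSeq N f t) (f t)) *
      qpT n f * h + X ^ (f (n + 1) * (f (n + 1) + 1) / 2) * ih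

theorem constantCoeff_qpT (r : ℕ) (f : ℕ → ℕ) : constantCoeff (qpT r f) = 1 := by
  rw [qpT, map_prod]
  exact Finset.prod_eq_one fun i _ => constantCoeff_qp _

theorem X_pow_dvd_prod_distinctGF_sub {r : ℕ} (hr : 1 ≤ r) (d : ℕ) (f : DecTuple r) :
    (X : ℚ⟦X⟧) ^ (d + 1) ∣ ∏ t ∈ Finset.range r, distinctGF (consSeq d f.1 t) (f.1 t) -
      X ^ (∑ t ∈ Finset.range r, f.1 t * (f.1 t + 1) / 2) * (qpT r f.1)⁻¹ := by
  obtain ⟨n, rfl⟩ : ∃ n, r = n + 1 := ⟨r - 1, by omega⟩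
  have h := prod_distinctGF_mul_qpT n d f.1 fun i j hij => f.2.1 hij
  have hT : qpT (n + 1) f.1 = qpT n f.1 * qp (f.1 n) := by
    rw [qpT_succ, f.2.2 (n + 1) le_rfl, Nat.sub_zero]
  have hc : constantCoeff (qpT (n + 1) f.1) ≠ 0 := by
    rw [constantCoeff_qpT]
    exact one_ne_zero
  have hu : IsUnit (qpT (n + 1) f.1) := PowerSeries.isUnit_iff_constantCoeff.2 hc.isUnit
  rw [← hu.dvd_mul_right, sub_mul, mul_assoc _ (qpT (n + 1) f.1)⁻¹, PowerSeries.inv_mul_cancel _ hc,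
    mul_one, hT, ← mul_assoc, h, Finset.sum_range_succ',
    pow_add _ (∑ t ∈ Finset.range n, _), mul_comm (X ^ _) (X ^ (_ / 2)),
    ← sub_mul]
  exact (X_pow_dvd_distinctGF_mul_qp_sub d (f.1 0)).mul_right _

theorem prod_markedWeight (r p i N : ℕ) (h : p + i ≤ r) (f : ℕ → ℕ) :
    ∏ t ∈ Finset.range r, markedWeight p i t (consSeq N f t) (f t) =
      (∏ t ∈ Finset.range r, distinctGF (consSeq N f t) (f t)) *
        X ^ ∑ j ∈ Finset.range i, (consSeq N f (p + j) + 1) := by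
  simp only [markedWeight]
  rw [Finset.prod_mul_distrib, mul_comm, ← Finset.prod_filter, ← Finset.prod_pow_eq_pow_sum]
  congr 1
  have hI : (Finset.range r).filter (fun t => p ≤ t ∧ t < p + i) = Finset.Ico p (p + i) := by
    ext t
    simp only [Finset.mem_filter, Finset.mem_range, Finset.mem_Ico]
    omega
  rw [hI, Finset.prod_Ico_eq_prod_range, Nat.add_sub_cancel_left]

theorem sum_prod_markedWeight {r m : ℕ} (hm : m < r) (N : ℕ) (f : ℕ → ℕ) :
    ∑ i ∈ Finset.range (m + 1),
        ∏ t ∈ Finset.range r, markedWeight (r - m) i t (consSeq N f t) (f t) =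
      (∏ t ∈ Finset.range r, distinctGF (consSeq N f t) (f t)) *
        (1 + ∑ i ∈ Finset.range m, X ^ ∑ j ∈ Finset.range (i + 1), (f (r - m - 1 + j) + 1)) := by
  rw [Finset.sum_range_succ', add_comm, mul_add, Finset.mul_sum]
  congr 1
  · rw [prod_markedWeight _ _ _ _ (by omega)]
    simp
  · refine Finset.sum_congr rfl fun i hi => ?_
    rw [Finset.mem_range] at hi
    rw [prod_markedWeight _ _ _ _ (by omega)]
    congr 2
    refine Finset.sum_congr rfl fun j _ => ?_
    rw [show r - m + j = r - m - 1 + j + 1 by omega]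
    rfl

theorem pathSum_relaxedWeight_eq_sum_prod {r m : ℕ} (hm : m < r) (d : ℕ) :
    pathSum (d + 2) r (relaxedWeight (r - m)) d = ∑ ρ : Fin r → Fin (d + 2),
      (∏ t ∈ Finset.range r, distinctGF (consSeq d (extendZero ρ) t) (extendZero ρ t)) *
        (1 + ∑ i ∈ Finset.range m,
          X ^ ∑ j ∈ Finset.range (i + 1), (extendZero ρ (r - m - 1 + j) + 1)) := by
  have h := pathSum_relaxedWeight (d + 2) m (r - m) d (by omega)
  rw [Nat.sub_add_cancel hm.le] at h
  simp only [h, pathSum_eq_sum]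
  rw [Finset.sum_comm]
  exact Finset.sum_congr rfl fun ρ _ => sum_prod_markedWeight hm d _

theorem prod_distinctGF_eq_zero {r N : ℕ} {f : ℕ → ℕ} (hf0 : ∀ t, r ≤ t → f t = 0)
    (hf : ¬ Antitone f) : ∏ t ∈ Finset.range r, distinctGF (consSeq N f t) (f t) = 0 := by
  obtain ⟨t, ht⟩ : ∃ t, f t < f (t + 1) := by
    by_contra! h
    exact hf (antitone_nat_of_succ_le h)
  have htr : t + 1 < r := by
    by_contra! h
    rw [hf0 _ h] at ht
    omega
  exact Finset.prod_eq_zero (Finset.mem_range.2 htr) (distinctGF_eq_zero ht)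

theorem extendZero_eq_zero {r M : ℕ} (ρ : Fin r → Fin M) {t : ℕ} (h : r ≤ t) :
    extendZero ρ t = 0 := dif_neg (by omega)

theorem hasSum_coeff_DecTuple {r m : ℕ} (hm : m < r) (d : ℕ) :
    HasSum (fun f : DecTuple r => coeff d
        ((X : ℚ⟦X⟧) ^ (∑ i ∈ Finset.range r, f.1 i * (f.1 i + 1) / 2) * (qpT r f.1)⁻¹ *
          (1 + ∑ i ∈ Finset.range m,
            (X : ℚ⟦X⟧) ^ ∑ j ∈ Finset.range (i + 1), (f.1 (r - m - 1 + j) + 1))))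
      (coeff d (pathSum (d + 2) r (relaxedWeight (r - m)) d)) := by
  classical
  let s : Finset (Fin r → Fin (d + 2)) := Finset.univ.filter fun ρ => Antitone (extendZero ρ)
  have hs : ∀ ρ : s, Antitone (extendZero ρ.1) := fun ρ => (Finset.mem_filter.1 ρ.2).2
  let g : s → DecTuple r :=
    fun ρ => ⟨extendZero ρ.1, fun i j hij => hs ρ hij, fun i hi => extendZero_eq_zero _ hi⟩
  have hg : Function.Injective g := by
    intro ρ σ h
    refine Subtype.ext (funext fun i => Fin.ext ?_)
    rw [← extendZero_coe, ← extendZero_coe]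
    exact congrFun (congrArg Subtype.val h) i
  rw [← hg.hasSum_iff]
  · rw [pathSum_relaxedWeight_eq_sum_prod hm, map_sum,
      ← Finset.sum_subset (Finset.subset_univ s), ← Finset.sum_coe_sort]
    · convert hasSum_fintype _ using 3 with ρ
      rw [Function.comp_apply, ← sub_eq_zero, ← map_sub, ← sub_mul]
      refine PowerSeries.X_pow_dvd_iff.1 ?_ d d.lt_succ_self
      exact (X_pow_dvd_prod_distinctGF_sub (by omega) d (g ρ)).mul_right _
    · intro ρ _ hρ
      rw [prod_distinctGF_eq_zero (fun t ht => extendZero_eq_zero _ ht)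
        (by simpa [s] using hρ), zero_mul, map_zero]
  · intro f hf
    rw [mul_assoc]
    refine PowerSeries.X_pow_dvd_iff.1 (Dvd.intro _ rfl) d ?_
    by_contra! hd
    have hlt : ∀ i, f.1 i < d + 2 := by
      intro i
      have h0 : f.1 0 * (f.1 0 + 1) / 2 ≤ ∑ i ∈ Finset.range r, f.1 i * (f.1 i + 1) / 2 :=
        Finset.single_le_sum (f := fun i => f.1 i * (f.1 i + 1) / 2) (fun _ _ => Nat.zero_le _)
          (Finset.mem_range.2 (by omega))
      have h1 := le_triangle (f.1 0)
      have h2 := f.2.1 (Nat.zero_le i)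
      omega
    have he : extendZero (fun i : Fin r => (⟨f.1 i, hlt i⟩ : Fin (d + 2))) = f.1 := by
      funext t
      by_cases ht : t < r
      · simp [extendZero, ht]
      · rw [extendZero_eq_zero _ (by omega), f.2.2 t (by omega)]
    refine hf ⟨⟨fun i => ⟨f.1 i, hlt i⟩, ?_⟩, Subtype.ext he⟩
    rw [Finset.mem_filter, he]
    exact ⟨Finset.mem_univ _, fun i j hij => f.2.1 hij⟩

/-- `Σ_{S(r,m)} q^{Σ|λ^{(i)}|} = Σ_{ρ_1 ≥ … ≥ ρ_r ≥ 0} q^{Σ ρ_i(ρ_i+1)/2}/(q)_ρ ·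
(1 + Σ_{i=0}^{m-1} q^{Σ_{j=0}^{i}(ρ_{r-m+j}+1)})`  (`f.1 t` is `ρ_{t+1}`). -/
theorem stmt3 (r m : ℕ) (hr : 1 ≤ r) (hm : m ≤ r - 1) :
    (∑' L : Srm r m, (X : ℚ⟦X⟧) ^ ∑ i ∈ Finset.range r, (L.1 i).sum id) =
      ∑' f : DecTuple r,
        (X : ℚ⟦X⟧) ^ (∑ i ∈ Finset.range r, f.1 i * (f.1 i + 1) / 2) * (qpT r f.1)⁻¹ *
          (1 + ∑ i ∈ Finset.range m,
            (X : ℚ⟦X⟧) ^ ∑ j ∈ Finset.range (i + 1), (f.1 (r - m - 1 + j) + 1)) := by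
  have hmr : m < r := by omega
  have : T2Space ℚ⟦X⟧ := inferInstanceAs (T2Space ((Unit →₀ ℕ) → ℚ))
  have hL := (hasSum_powerSeries_iff _ (mk fun d => coeff d
    (pathSum (d + 2) r (relaxedWeight (r - m)) d))).2 fun d =>
      by rw [coeff_mk]; exact hasSum_coeff_Srm hmr d
  have hR := (hasSum_powerSeries_iff _ (mk fun d => coeff d
    (pathSum (d + 2) r (relaxedWeight (r - m)) d))).2 fun d =>
      by rw [coeff_mk]; exact hasSum_coeff_DecTuple hmr d
  exact hL.tsum_eq.trans hR.tsum_eq.symm
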